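/- Let d ≥ 1 and let π and σ be permutations of {1,…,d}. Let G be the pair of d-dimensional layer-permuted butterflies with permutations (π,σ). Then for every set A of input nodes of G and every set B of output nodes of G with |A| = |B|, there exists a node-disjoint routing from A to B. In other words, every pair of d-dimensional layer-permuted butterflies is a superconcentrator. -/

import Mathlib

/-- Edge relation of a pair of `d`-dimensional layer-permuted butterflies with layer
permutations `π` (left butterfly, layers `0,…,d`) and `σ` (right butterfly, layers
`d,…,2d`), glued by identifying the layer-`d` vertex labelled `b` of the left butterfly
with the layer-`d` vertex labelled `b` of the right butterfly.  `lpStep d π σ i b b'`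
says there is a directed edge from the vertex with label `b` on layer `i` to the vertex
with label `b'` on layer `i+1`: crossing the `(i+1)`-st layer of edges of the left
butterfly may change exactly coordinate `π(i+1)`, and crossing the `(j+1)`-st layer of
edges of the right butterfly (i.e. `i = d + j`) may change exactly coordinate `σ(j+1)`
(all indices `0`-based here). -/
def lpStep (d : ℕ) (π σ : Equiv.Perm (Fin d)) (i : ℕ) (b b' : Fin d → Bool) : Prop :=
  if h : i < d then
    ∀ k : Fin d, k ≠ π ⟨i, h⟩ → b k = b' k
  else if h' : i < 2 * d then
    ∀ k : Fin d, k ≠ σ ⟨i - d, by omega⟩ → b k = b' k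
  else False

/-- `x` and `y` agree in the first `j` coordinates in the order given by `π`. -/
def lpE {d : ℕ} (π : Equiv.Perm (Fin d)) (j : ℕ) (x y : Fin d → Bool) : Prop :=
  ∀ i : Fin d, i.val < j → x (π i) = y (π i)

lemma lpE_symm {d : ℕ} {π : Equiv.Perm (Fin d)} {j : ℕ} {x y : Fin d → Bool}
    (h : lpE π j x y) : lpE π j y x := fun i hi => (h i hi).symm

lemma lpE_trans {d : ℕ} {π : Equiv.Perm (Fin d)} {j : ℕ} {x y z : Fin d → Bool}
    (h : lpE π j x y) (h' : lpE π j y z) : lpE π j x z :=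
  fun i hi => (h i hi).trans (h' i hi)

lemma lpE_refl {d : ℕ} (π : Equiv.Perm (Fin d)) (j : ℕ) (x : Fin d → Bool) :
    lpE π j x x := fun _ _ => rfl

lemma lpE_mono {d : ℕ} {π : Equiv.Perm (Fin d)} {j i : ℕ} {x y : Fin d → Bool}
    (hij : i ≤ j) (h : lpE π j x y) : lpE π i x y := fun k hk => h k (by omega)

lemma lpE_full {d : ℕ} {π : Equiv.Perm (Fin d)} {x y : Fin d → Bool}
    (h : lpE π d x y) : x = y := by
  funext k
  have := h (π.symm k) (π.symm k).2
  simpa using this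

lemma lpE_succ {d : ℕ} {π : Equiv.Perm (Fin d)} {j : ℕ} (hj : j < d) {x y : Fin d → Bool} :
    lpE π (j+1) x y ↔ lpE π j x y ∧ x (π ⟨j, hj⟩) = y (π ⟨j, hj⟩) := by
  constructor
  · intro h
    exact ⟨lpE_mono (by omega) h, h ⟨j, hj⟩ (by simp)⟩
  · rintro ⟨h, h'⟩ i hi
    by_cases hij : i.val = j
    · have : i = ⟨j, hj⟩ := Fin.ext hij
      rw [this]; exact h'
    · exact h i (by omega)

lemma lp_matching {d : ℕ} (π : Equiv.Perm (Fin d)) (S : Finset (Fin d → Bool)) (n : ℕ) :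
    ∀ j, j + n = d → ∃ a : (Fin d → Bool) → (Fin d → Bool), (∀ x, a (a x) = x) ∧
      (∀ x ∈ S, a x ∈ S) ∧ (∀ x, lpE π j x (a x)) ∧
      ∀ i, j ≤ i → i ≤ d → ∀ x ∈ S, ∀ y ∈ S, lpE π i x y →
        (a x = x ∨ ¬ lpE π i x (a x)) → (a y = y ∨ ¬ lpE π i y (a y)) → x = y := by
  classical
  induction n with
  | zero =>
    intro j hj
    refine ⟨id, fun _ => rfl, fun _ h => h, fun x => lpE_refl π j x, ?_⟩
    intro i h1 h2 x _ y _ hxy _ _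
    have : i = d := by omega
    subst this
    exact lpE_full hxy
  | succ n ih =>
    intro j hj
    obtain ⟨a, ha, haS, haE, hab⟩ := ih (j+1) (by omega)
    have hjd : j < d := by omega
    let R : (Fin d → Bool) → (Fin d → Bool) → Prop := fun x y =>
      x ∈ S ∧ y ∈ S ∧ a x = x ∧ a y = y ∧ x ≠ y ∧ lpE π j x y
    have Rsymm : ∀ x y, R x y → R y x := by
      rintro x y ⟨h1, h2, h3, h4, h5, h6⟩
      exact ⟨h2, h1, h4, h3, h5.symm, lpE_symm h6⟩
    have Rne : ∀ x y, R x y → x (π ⟨j, hjd⟩) ≠ y (π ⟨j, hjd⟩) := by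
      rintro x y ⟨h1, h2, h3, h4, h5, h6⟩ h
      exact h5 (hab (j+1) le_rfl (by omega) x h1 y h2 ((lpE_succ hjd).2 ⟨h6, h⟩)
        (Or.inl h3) (Or.inl h4))
    have Runiq : ∀ x y z, R x y → R x z → y = z := by
      intro x y z h h'
      have n1 := Rne _ _ h
      have n2 := Rne _ _ h'
      obtain ⟨h1, h2, h3, h4, h5, h6⟩ := h
      obtain ⟨g1, g2, g3, g4, g5, g6⟩ := h'
      refine hab (j+1) le_rfl (by omega) y h2 z g2 ((lpE_succ hjd).2 ⟨lpE_trans (lpE_symm h6) g6, ?_⟩)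
        (Or.inl h4) (Or.inl g4)
      revert n1 n2
      generalize x (π ⟨j, hjd⟩) = p
      generalize y (π ⟨j, hjd⟩) = q
      generalize z (π ⟨j, hjd⟩) = r
      revert p q r
      decide
    let a' : (Fin d → Bool) → (Fin d → Bool) := fun x =>
      if h : ∃ y, R x y then h.choose else a x
    have a'R : ∀ x y, R x y → a' x = y := by
      intro x y h
      have hex : ∃ y, R x y := ⟨y, h⟩
      simp only [a', dif_pos hex]
      exact Runiq x _ _ hex.choose_spec h
    have a'N : ∀ x, (¬ ∃ y, R x y) → a' x = a x := by
      intro x h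
      simp only [a', dif_neg h]
    refine ⟨a', ?_, ?_, ?_, ?_⟩
    · intro x
      by_cases h : ∃ y, R x y
      · obtain ⟨y, hy⟩ := h
        rw [a'R x y hy, a'R y x (Rsymm _ _ hy)]
      · rw [a'N x h, a'N (a x), ha]
        rintro ⟨y, hy⟩
        have : a x = x := by
          have := hy.2.2.1
          rw [ha] at this
          exact this.symm
        rw [this] at hy
        exact h ⟨y, hy⟩
    · intro x hx
      by_cases h : ∃ y, R x y
      · obtain ⟨y, hy⟩ := h
        rw [a'R x y hy]; exact hy.2.1
      · rw [a'N x h]; exact haS x hx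
    · intro x
      by_cases h : ∃ y, R x y
      · obtain ⟨y, hy⟩ := h
        rw [a'R x y hy]; exact hy.2.2.2.2.2
      · rw [a'N x h]; exact lpE_mono (by omega) (haE x)
    · have key : ∀ i, ∀ x, (a' x = x ∨ ¬ lpE π i x (a' x)) → (a x = x ∨ ¬ lpE π i x (a x)) := by
        intro i x hb
        by_cases h : ∃ y, R x y
        · obtain ⟨y, hy⟩ := h
          exact Or.inl hy.2.2.1
        · rwa [a'N x h] at hb
      have key2 : ∀ x, (a' x = x ∨ ¬ lpE π j x (a' x)) → a x = x ∧ ¬ ∃ y, R x y := by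
        intro x hb
        by_cases h : ∃ y, R x y
        · obtain ⟨y, hy⟩ := h
          rw [a'R x y hy] at hb
          rcases hb with hb | hb
          · exact absurd hb.symm hy.2.2.2.2.1
          · exact absurd hy.2.2.2.2.2 hb
        · rw [a'N x h] at hb
          rcases hb with hb | hb
          · exact ⟨hb, h⟩
          · exact absurd (lpE_mono (by omega) (haE x)) hb
      intro i hi hid x hx y hy hxy bx bY
      by_cases hij : i = j
      · subst hij
        by_contra hne
        exact (key2 x bx).2 ⟨y, hx, hy, (key2 x bx).1, (key2 y bY).1, hne, hxy⟩
      · exact hab i (by omega) hid x hx y hy hxy (key i x bx) (key i y bY)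

set_option maxHeartbeats 2000000 in
lemma lp_color {X : Type*} [Fintype X] (n : ℕ) : ∀ a b : X → X, (∀ x, a (a x) = x) →
    (∀ x, b (b x) = x) → {x | a x ≠ x}.ncard ≤ n →
    ∃ f : X → Bool, ∀ x, (a x ≠ x → f (a x) ≠ f x) ∧ (b x ≠ x → f (b x) ≠ f x) := by
  classical
  induction n with
  | zero =>
    intro a b ha hb h
    have h0 : {x | a x ≠ x} = ∅ := by
      rw [← Set.ncard_eq_zero (Set.toFinite _)]; omega
    let e := Fintype.equivFin X
    refine ⟨fun x => decide (e x < e (b x)), fun x => ⟨?_, ?_⟩⟩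
    · intro hx
      have : x ∈ {x | a x ≠ x} := hx
      rw [h0] at this
      exact this.elim
    · intro hx
      have hne : e (b x) ≠ e x := fun h => hx (e.injective h)
      simp only [hb]
      rcases lt_or_gt_of_ne hne with h | h
      · simp [h, h.le]
      · simp [h, h.le]
  | succ n ih =>
    intro a b ha hb h
    by_cases hall : ∀ x, a x = x
    · apply ih a b ha hb
      have : {x | a x ≠ x} = ∅ := by ext x; simp [hall x]
      rw [this]; simp
    · push Not at hall
      obtain ⟨x, hx⟩ := hall
      obtain ⟨y, hy⟩ : ∃ y, y = a x := ⟨_, rfl⟩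
      have hyx : a y = x := by rw [hy, ha]
      have hne : y ≠ x := by rw [hy]; exact hx
      let a' : X → X := fun z => if z = x ∨ z = y then z else a z
      let b' : X → X := fun z => if z = x ∨ z = y then z else
        if b z = x then (if b y = y then z else b y) else
        if b z = y then (if b x = x then z else b x) else b z
      have ha' : ∀ z, a' (a' z) = z := by
        intro z; simp only [a']; grind
      have hb' : ∀ z, b' (b' z) = z := by
        intro z; simp only [b']; grind
      have hc : {x | a' x ≠ x}.ncard ≤ n := by
        have : {z | a' z ≠ z} ⊂ {z | a z ≠ z} := by
          refine ⟨?_, ?_⟩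
          · intro z hz; simp only [Set.mem_ofPred_eq, a'] at hz ⊢; grind
          · intro hs
            have : x ∈ {z | a' z ≠ z} := hs hx
            simp [a'] at this
        have := Set.ncard_lt_ncard this (Set.toFinite _)
        omega
      obtain ⟨f, hf⟩ := ih a' b' ha' hb' hc
      let fx : Bool := if b x = x ∨ b x = y then (if b y = y ∨ b y = x then true else f (b y))
        else !f (b x)
      refine ⟨fun z => if z = x then fx else if z = y then !fx else f z, ?_⟩
      intro z
      have h1 := hf z
      have h2 := hf (b x)
      have h3 := hf (b y)
      simp only [a', b', fx] at h1 h2 h3 ⊢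
      have e1 := hb x
      have e2 := hb y
      have e3 := hb z
      have e4 := ha z
      have e5 : b x ≠ b y := fun h => hne (by rw [← e1, ← e2, h])
      refine ⟨?_, ?_⟩
      · grind
      · clear h ih hf ha' hb' hc ha e4 hx
        by_cases c1 : z = x
        · subst c1; cases hfx : f (b z) <;> grind
        by_cases c2 : z = y
        · subst c2; cases hfx : f (b x) <;> grind
        by_cases c3 : b z = x
        · cases hfx : f (b x) <;> grind
        by_cases c4 : b z = y
        · cases hfx : f (b x) <;> grind
        grind

lemma lp_disc_one {d : ℕ} (π : Equiv.Perm (Fin d)) (S : Finset (Fin d → Bool))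
    (a : (Fin d → Bool) → (Fin d → Bool)) (ha : ∀ x, a (a x) = x) (haS : ∀ x ∈ S, a x ∈ S)
    (i : ℕ)
    (hab : ∀ x ∈ S, ∀ y ∈ S, lpE π i x y →
        (a x = x ∨ ¬ lpE π i x (a x)) → (a y = y ∨ ¬ lpE π i y (a y)) → x = y)
    (f : (Fin d → Bool) → Bool) (hf : ∀ x, a x ≠ x → f (a x) ≠ f x) (n : Fin d → Bool)
    (N : Finset (Fin d → Bool)) (hN : ∀ x, x ∈ N ↔ lpE π i n x) :
    |∑ x ∈ N, (if x ∈ S then (if f x then (1:ℤ) else -1) else 0)| ≤ 1 := by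
  classical
  rw [← Finset.sum_filter]
  set T := N.filter (· ∈ S) with hT
  rw [← Finset.sum_filter_add_sum_filter_not T (fun x => a x ≠ x ∧ lpE π i x (a x))]
  have h0 : ∑ x ∈ T with (a x ≠ x ∧ lpE π i x (a x)), (if f x then (1:ℤ) else -1) = 0 := by
    apply Finset.sum_involution (fun x _ => a x)
    · intro x hx
      simp only [Finset.mem_filter] at hx
      have := hf x hx.2.1
      cases h1 : f x <;> cases h2 : f (a x) <;> simp_all
    · intro x hx _
      simp only [Finset.mem_filter] at hx
      exact hx.2.1
    · intro x hx
      simp only [hT, Finset.mem_filter, hN] at hx ⊢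
      refine ⟨⟨lpE_trans hx.1.1 hx.2.2, haS x hx.1.2⟩, ?_, ?_⟩
      · rw [ha]; exact hx.2.1.symm
      · rw [ha]; exact lpE_symm hx.2.2
    · intro x _; exact ha x
  rw [h0, zero_add]
  have hc : (T.filter (fun x => ¬ (a x ≠ x ∧ lpE π i x (a x)))).card ≤ 1 := by
    rw [Finset.card_le_one]
    intro x hx y hy
    simp only [hT, Finset.mem_filter, hN] at hx hy
    exact hab x hx.1.2 y hy.1.2 (lpE_trans (lpE_symm hx.1.1) hy.1.1) (by tauto) (by tauto)
  calc _ ≤ ∑ x ∈ T with ¬ (a x ≠ x ∧ lpE π i x (a x)), |(if f x then (1:ℤ) else -1)| :=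
        Finset.abs_sum_le_sum_abs _ _
    _ = ∑ x ∈ T with ¬ (a x ≠ x ∧ lpE π i x (a x)), 1 := by
        apply Finset.sum_congr rfl
        intro x _
        split_ifs <;> simp
    _ ≤ 1 := by
        rw [Finset.sum_const]; simp only [nsmul_eq_mul, mul_one]; exact_mod_cast hc

/-- The family of trie nodes. -/
def lpNode {d : ℕ} (π : Equiv.Perm (Fin d)) (N : Finset (Fin d → Bool)) : Prop :=
  ∃ i n, i ≤ d ∧ ∀ x, x ∈ N ↔ lpE π i n x

lemma lp_disc {d : ℕ} (π σ : Equiv.Perm (Fin d)) (S : Finset (Fin d → Bool)) :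
    ∃ f : (Fin d → Bool) → Bool, ∀ N, (lpNode π N ∨ lpNode σ N) →
      |∑ x ∈ N, (if x ∈ S then (if f x then (1:ℤ) else -1) else 0)| ≤ 1 := by
  obtain ⟨a, ha, haS, -, hab⟩ := lp_matching π S d 0 (by omega)
  obtain ⟨b, hb, hbS, -, hbb⟩ := lp_matching σ S d 0 (by omega)
  obtain ⟨f, hf⟩ := lp_color _ a b ha hb le_rfl
  refine ⟨f, ?_⟩
  rintro N (⟨i, n, hi, hN⟩ | ⟨i, n, hi, hN⟩)
  · exact lp_disc_one π S a ha haS i (hab i (by omega) hi) f (fun x => (hf x).1) n N hN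
  · exact lp_disc_one σ S b hb hbS i (hbb i (by omega) hi) f (fun x => (hf x).2) n N hN

lemma lp_round {X : Type*} [Fintype X] [DecidableEq X] (F : Finset X → Prop)
    (hF : ∀ S : Finset X, ∃ f : X → Bool, ∀ N, F N →
      |∑ x ∈ N, (if x ∈ S then (if f x then (1:ℤ) else -1) else 0)| ≤ 1) (t : ℕ) :
    ∀ w : X → ℤ, (∀ x, 0 ≤ w x ∧ w x ≤ 2 ^ t) → ∃ M : Finset X, ∀ N, F N →
      |2 ^ t * ((M ∩ N).card : ℤ) - ∑ x ∈ N, w x| ≤ 2 ^ t - 1 := by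
  induction t with
  | zero =>
    intro w hw
    refine ⟨Finset.univ.filter (fun x => w x = 1), fun N _ => ?_⟩
    have : ∑ x ∈ N, w x = ((Finset.univ.filter (fun x => w x = 1) ∩ N).card : ℤ) := by
      rw [Finset.inter_comm, Finset.inter_filter, Finset.inter_univ, Finset.card_filter]
      push_cast
      apply Finset.sum_congr rfl
      intro x _
      have := hw x
      split_ifs <;> omega
    rw [this]; simp
  | succ t ih =>
    intro w hw
    obtain ⟨f, hf⟩ := hF (Finset.univ.filter (fun x => w x % 2 = 1))
    let g : X → ℤ := fun x => if x ∈ (Finset.univ.filter (fun x => w x % 2 = 1)) then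
      (if f x then (1:ℤ) else -1) else 0
    have hg : ∀ x, 2 * ((w x + g x) / 2) = w x + g x ∧ 0 ≤ (w x + g x) / 2 ∧
        (w x + g x) / 2 ≤ 2 ^ t := by
      intro x
      have h1 := hw x
      rw [pow_succ] at h1
      simp only [g, Finset.mem_filter, Finset.mem_univ, true_and]
      split_ifs <;> omega
    obtain ⟨M, hM⟩ := ih (fun x => (w x + g x) / 2) (fun x => (hg x).2)
    refine ⟨M, fun N hN => ?_⟩
    have h1 := hM N hN
    have h2 : |∑ x ∈ N, g x| ≤ 1 := hf N hN
    have h3 : 2 * ∑ x ∈ N, (w x + g x) / 2 = ∑ x ∈ N, w x + ∑ x ∈ N, g x := by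
      rw [Finset.mul_sum, ← Finset.sum_add_distrib]
      exact Finset.sum_congr rfl fun x _ => (hg x).1
    rw [abs_le] at h1 h2 ⊢
    rw [pow_succ]
    constructor <;> nlinarith [h1.1, h1.2, h2.1, h2.2]

/-- Balancedness of a set of labels in the trie of `π`. -/
def lpBal {d : ℕ} (π : Equiv.Perm (Fin d)) (M : Finset (Fin d → Bool)) : Prop :=
  ∀ j (hj : j < d) (n : Fin d → Bool) (N : Bool → Finset (Fin d → Bool)),
    (∀ v x, x ∈ N v ↔ x ∈ M ∧ lpE π j n x ∧ x (π ⟨j, hj⟩) = v) →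
    (N false).card ≤ (N true).card + 1 ∧ (N true).card ≤ (N false).card + 1

lemma lp_node_child {d : ℕ} (π : Equiv.Perm (Fin d)) (j : ℕ) (hj : j < d) (n x : Fin d → Bool)
    (v : Bool) : lpE π (j+1) (Function.update n (π ⟨j, hj⟩) v) x ↔
      lpE π j n x ∧ x (π ⟨j, hj⟩) = v := by
  rw [lpE_succ hj]
  simp only [Function.update_self]
  have : lpE π j (Function.update n (π ⟨j, hj⟩) v) x ↔ lpE π j n x := by
    unfold lpE
    refine forall_congr' fun i => imp_congr_right fun hi => ?_
    rw [Function.update_of_ne]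
    intro h
    have := π.injective h
    rw [this] at hi
    simp at hi
  rw [this]
  tauto

lemma lp_bal_of {d : ℕ} (π : Equiv.Perm (Fin d)) (M : Finset (Fin d → Bool)) (k : ℤ)
    (hM : ∀ N, lpNode π N → |2 ^ d * ((M ∩ N).card : ℤ) - ∑ x ∈ N, k| ≤ 2 ^ d - 1) :
    lpBal π M := by
  classical
  intro j hj n N hN
  let C : Bool → Finset (Fin d → Bool) := fun v =>
    Finset.univ.filter (fun x => lpE π (j+1) (Function.update n (π ⟨j, hj⟩) v) x)
  have hC : ∀ v x, x ∈ C v ↔ lpE π j n x ∧ x (π ⟨j, hj⟩) = v := by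
    intro v x
    simp only [C, Finset.mem_filter, Finset.mem_univ, true_and, lp_node_child]
  have hCN : ∀ v, M ∩ C v = N v := by
    intro v; ext x; rw [Finset.mem_inter, hC, hN]
  have hnode : ∀ v, lpNode π (C v) := fun v =>
    ⟨j+1, Function.update n (π ⟨j, hj⟩) v, hj, fun x => by simp [C]⟩
  have hcard : (C false).card = (C true).card := by
    have hfl : ∀ (x : Fin d → Bool) v, lpE π j n (Function.update x (π ⟨j, hj⟩) v) ↔ lpE π j n x := by
      intro x v
      have := lp_node_child π j hj x n v
      constructor
      · intro h
        have h2 := (lp_node_child π j hj x (Function.update x (π ⟨j, hj⟩) v) v).1 (lpE_refl _ _ _)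
        exact lpE_trans h (lpE_symm h2.1)
      · intro h
        have h2 := (lp_node_child π j hj x (Function.update x (π ⟨j, hj⟩) v) v).1 (lpE_refl _ _ _)
        exact lpE_trans h h2.1
    apply Finset.card_bij' (fun x _ => Function.update x (π ⟨j, hj⟩) true)
      (fun x _ => Function.update x (π ⟨j, hj⟩) false)
    · intro x hx; rw [hC] at hx; simp [← hx.2]
    · intro x hx; rw [hC] at hx; simp [← hx.2]
    · intro x hx; rw [hC] at hx ⊢; rw [hfl]; exact ⟨hx.1, by simp⟩
    · intro x hx; rw [hC] at hx ⊢; rw [hfl]; exact ⟨hx.1, by simp⟩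
  have h0 := hM _ (hnode false)
  have h1 := hM _ (hnode true)
  rw [hCN, Finset.sum_const, abs_le] at h0 h1
  rw [hcard] at h0
  generalize (C true).card • k = s at h0 h1
  have hp : (0:ℤ) < 2 ^ d := by positivity
  generalize (2:ℤ) ^ d = p at h0 h1 hp
  constructor
  · have : ((N false).card : ℤ) < (N true).card + 2 := by
      by_contra hcon
      push Not at hcon
      nlinarith [mul_le_mul_of_nonneg_left hcon hp.le]
    omega
  · have : ((N true).card : ℤ) < (N false).card + 2 := by
      by_contra hcon
      push Not at hcon
      nlinarith [mul_le_mul_of_nonneg_left hcon hp.le]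
    omega

lemma lp_exists_bal {d : ℕ} (π σ : Equiv.Perm (Fin d)) (k : ℕ) (hk : k ≤ 2 ^ d) :
    ∃ M : Finset (Fin d → Bool), M.card = k ∧ lpBal π M ∧ lpBal σ M := by
  obtain ⟨M, hM⟩ := lp_round (fun N => lpNode π N ∨ lpNode σ N) (lp_disc π σ) d
    (fun _ => (k:ℤ)) (fun _ => ⟨by positivity, by exact_mod_cast hk⟩)
  refine ⟨M, ?_, lp_bal_of π M k fun N hN => hM N (Or.inl hN),
    lp_bal_of σ M k fun N hN => hM N (Or.inr hN)⟩
  have := hM Finset.univ (Or.inl ⟨0, fun _ => false, by omega, fun x => by simp [lpE]⟩)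
  rw [Finset.inter_univ, Finset.sum_const, Finset.card_univ] at this
  simp only [Fintype.card_fun, Fintype.card_bool, Fintype.card_fin, nsmul_eq_mul] at this
  push_cast at this
  rw [← mul_sub, abs_mul, abs_of_pos (by positivity : (0:ℤ) < 2 ^ d)] at this
  have hp : (0:ℤ) < 2 ^ d := by positivity
  have h2 : |(M.card : ℤ) - k| < 1 := by
    by_contra hcon
    push Not at hcon
    nlinarith
  rw [Int.abs_lt_one_iff] at h2
  omega

lemma lp_layer {d : ℕ} (π : Equiv.Perm (Fin d)) (M : Finset (Fin d → Bool)) (hM : lpBal π M)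
    (j : ℕ) (hj : j < d) (A : Finset (Fin d → Bool))
    (hA : ∀ n (N K : Finset (Fin d → Bool)), (∀ x, x ∈ N ↔ x ∈ A ∧ lpE π j n x) →
      (∀ x, x ∈ K ↔ x ∈ M ∧ lpE π j n x) → N.card = K.card) :
    ∃ g : (Fin d → Bool) → (Fin d → Bool), (∀ x k, k ≠ π ⟨j, hj⟩ → x k = g x k) ∧
      (∀ x ∈ A, ∀ y ∈ A, g x = g y → x = y) ∧
      ∀ n (N K : Finset (Fin d → Bool)), (∀ x, x ∈ N ↔ x ∈ A.image g ∧ lpE π (j+1) n x) →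
      (∀ x, x ∈ K ↔ x ∈ M ∧ lpE π (j+1) n x) → N.card = K.card := by
  classical
  obtain ⟨c, hc⟩ : ∃ c, c = π ⟨j, hj⟩ := ⟨_, rfl⟩
  rw [← hc]
  let fl : (Fin d → Bool) → (Fin d → Bool) := fun x => Function.update x c (!x c)
  have flfl : ∀ x, fl (fl x) = x := by intro x; simp [fl]
  have flc : ∀ x, fl x c = !x c := by intro x; simp [fl]
  have hup : ∀ (x : Fin d → Bool) v, lpE π j x (Function.update x c v) := by
    intro x v
    rw [hc]
    exact ((lp_node_child π j hj x (Function.update x (π ⟨j, hj⟩) v) v).1 (lpE_refl _ _ _)).1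
  have hflE : ∀ x, lpE π j x (fl x) := fun x => hup x _
  let ky : (Fin d → Bool) → (Fin d → Bool) := fun n k => if (π.symm k).val < j then n k else false
  have kyE : ∀ n, lpE π j n (ky n) := by
    intro n i hi; simp [ky, hi]
  have kyeq : ∀ n x, lpE π j n x → ky n = ky x := by
    intro n x h
    funext k
    simp only [ky]
    split_ifs with hk
    · have := h _ hk
      simpa using this
    · rfl
  -- choice of the singles sent to the `false` side
  have hT : ∀ n, ∃ T : Finset (Fin d → Bool),
      (∀ x ∈ T, x ∈ A ∧ lpE π j n x ∧ fl x ∉ A) ∧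
      T.card + (A.filter (fun x => lpE π j n x ∧ fl x ∈ A ∧ x c = false)).card =
        (M.filter (fun x => lpE π j n x ∧ x c = false)).card := by
    intro n
    have hb := hM j hj n (fun v => M.filter (fun x => lpE π j n x ∧ x c = v))
      (fun v x => by simp [hc])
    have ht := hA n (A.filter (fun x => lpE π j n x)) (M.filter (fun x => lpE π j n x))
      (by simp) (by simp)
    have hMs : (M.filter (fun x => lpE π j n x)).card =
        (M.filter (fun x => lpE π j n x ∧ x c = false)).card +
        (M.filter (fun x => lpE π j n x ∧ x c = true)).card := by
      rw [← Finset.card_filter_add_card_filter_not (s := M.filter (fun x => lpE π j n x))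
        (fun x => x c = false), Finset.filter_filter, Finset.filter_filter]
      simp
    have hAs : (A.filter (fun x => lpE π j n x)).card =
        (A.filter (fun x => lpE π j n x ∧ fl x ∈ A ∧ x c = false)).card +
        (A.filter (fun x => lpE π j n x ∧ fl x ∈ A ∧ x c = true)).card +
        (A.filter (fun x => lpE π j n x ∧ fl x ∉ A)).card := by
      rw [← Finset.card_filter_add_card_filter_not (s := A.filter (fun x => lpE π j n x))
        (fun x => fl x ∈ A), Finset.filter_filter, Finset.filter_filter]
      rw [← Finset.card_filter_add_card_filter_not
        (s := A.filter (fun x => lpE π j n x ∧ fl x ∈ A))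
        (fun x => x c = false), Finset.filter_filter, Finset.filter_filter]
      simp [and_assoc]
    have hpp : (A.filter (fun x => lpE π j n x ∧ fl x ∈ A ∧ x c = false)).card =
        (A.filter (fun x => lpE π j n x ∧ fl x ∈ A ∧ x c = true)).card := by
      apply Finset.card_bij' (fun x _ => fl x) (fun x _ => fl x)
      · intro x hx
        simp only [Finset.mem_filter] at hx ⊢
        exact ⟨hx.2.2.1, lpE_trans hx.2.1 (hflE x), by rw [flfl]; exact hx.1, by rw [flc, hx.2.2.2]; rfl⟩
      · intro x hx
        simp only [Finset.mem_filter] at hx ⊢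
        exact ⟨hx.2.2.1, lpE_trans hx.2.1 (hflE x), by rw [flfl]; exact hx.1, by rw [flc, hx.2.2.2]; rfl⟩
      · intro x _; exact flfl x
      · intro x _; exact flfl x
    obtain ⟨T, hTs, hTc⟩ := Finset.exists_subset_card_eq
      (s := A.filter (fun x => lpE π j n x ∧ fl x ∉ A))
      (n := (M.filter (fun x => lpE π j n x ∧ x c = false)).card -
        (A.filter (fun x => lpE π j n x ∧ fl x ∈ A ∧ x c = false)).card) (by omega)
    refine ⟨T, fun x hx => ?_, by omega⟩
    have := hTs hx
    simpa using this
  choose T hT1 hT2 using hT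
  let g : (Fin d → Bool) → (Fin d → Bool) := fun x =>
    if fl x ∈ A then x else if x ∈ T (ky x) then Function.update x c false
      else Function.update x c true
  have hgE : ∀ x, lpE π j x (g x) := by
    intro x
    simp only [g]
    split_ifs
    · exact lpE_refl _ _ _
    · exact hup x _
    · exact hup x _
  have hg1 : ∀ x k, k ≠ c → x k = g x k := by
    intro x k hk
    simp only [g]
    split_ifs <;> simp [Function.update_of_ne hk]
  have hginj : ∀ x ∈ A, ∀ y ∈ A, g x = g y → x = y := by
    intro x hx y hy h
    by_contra hne
    have hoff : ∀ k, k ≠ c → x k = y k := by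
      intro k hk; rw [hg1 x k hk, hg1 y k hk, h]
    have hfx : fl x = y := by
      funext k
      by_cases hk : k = c
      · subst hk
        rw [flc]
        by_contra h2
        apply hne
        funext l
        by_cases hl : l = k
        · subst hl
          revert h2
          cases x l <;> cases y l <;> simp
        · exact hoff l hl
      · simp only [fl, Function.update_of_ne hk]; exact hoff k hk
    have hfy : fl y = x := by rw [← hfx, flfl]
    have e1 : g x = x := by simp only [g, hfx, hy, if_true]
    have e2 : g y = y := by simp only [g, hfy, hx, if_true]
    rw [e1, e2] at h
    exact hne h
  have hcnt0 : ∀ n, (A.filter (fun x => lpE π j n x ∧ g x c = false)).card =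
      (M.filter (fun x => lpE π j n x ∧ x c = false)).card := by
    intro n
    have hk : ∀ x, lpE π j (ky n) x ↔ lpE π j n x := fun x =>
      ⟨fun h => lpE_trans (kyE n) h, fun h => lpE_trans (lpE_symm (kyE n)) h⟩
    have h2 := hT2 (ky n)
    have h1 := hT1 (ky n)
    simp only [hk] at h2 h1
    rw [← h2, ← Finset.card_union_of_disjoint]
    · congr 1
      ext x
      simp only [Finset.mem_filter, Finset.mem_union]
      constructor
      · rintro ⟨hx, hE, hgc⟩
        by_cases hf : fl x ∈ A
        · right
          simp only [g, hf, if_true] at hgc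
          exact ⟨hx, hE, hf, hgc⟩
        · left
          by_contra hnT
          rw [kyeq n x hE] at hnT
          simp [g, hf, hnT] at hgc
      · rintro (hx | ⟨hx, hE, hf, hv⟩)
        · obtain ⟨q1, q2, q3⟩ := h1 x hx
          refine ⟨q1, q2, ?_⟩
          rw [kyeq n x q2] at hx
          simp [g, q3, hx]
        · refine ⟨hx, hE, ?_⟩
          simp only [g, hf, if_true]; exact hv
    · rw [Finset.disjoint_left]
      intro x hx hx'
      simp only [Finset.mem_filter] at hx'
      exact (h1 x hx).2.2 hx'.2.2.1
  have hcnt1 : ∀ n, (A.filter (fun x => lpE π j n x ∧ g x c = true)).card =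
      (M.filter (fun x => lpE π j n x ∧ x c = true)).card := by
    intro n
    have ht := hA n (A.filter (fun x => lpE π j n x)) (M.filter (fun x => lpE π j n x))
      (by simp) (by simp)
    rw [← Finset.card_filter_add_card_filter_not (s := M.filter (fun x => lpE π j n x))
        (fun x => x c = false), Finset.filter_filter, Finset.filter_filter,
      ← Finset.card_filter_add_card_filter_not (s := A.filter (fun x => lpE π j n x))
        (fun x => g x c = false), Finset.filter_filter, Finset.filter_filter, hcnt0 n] at ht
    simpa using ht
  refine ⟨g, hg1, hginj, ?_⟩
  intro n N K hN hK
  have hcnt : (A.filter (fun x => lpE π j n x ∧ g x c = n c)).card =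
      (M.filter (fun x => lpE π j n x ∧ x c = n c)).card := by
    cases n c
    · exact hcnt0 n
    · exact hcnt1 n
  have hKe : K = M.filter (fun x => lpE π j n x ∧ x c = n c) := by
    ext x
    rw [hK, lpE_succ hj, ← hc, Finset.mem_filter, eq_comm (a := n c)]
  have hNe : N = (A.filter (fun x => lpE π j n x ∧ g x c = n c)).image g := by
    ext y
    rw [hN, lpE_succ hj, ← hc]
    simp only [Finset.mem_image, Finset.mem_filter]
    constructor
    · rintro ⟨⟨x, hx, rfl⟩, hE, hv⟩
      exact ⟨x, ⟨hx, lpE_trans hE (lpE_symm (hgE x)), hv.symm⟩, rfl⟩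
    · rintro ⟨x, ⟨hx, hE, hv⟩, rfl⟩
      exact ⟨⟨x, hx, rfl⟩, lpE_trans hE (hgE x), hv.symm⟩
  rw [hKe, hNe, Finset.card_image_of_injOn, hcnt]
  intro x hx y hy h
  simp only [Finset.coe_filter, Set.mem_ofPred_eq] at hx hy
  exact hginj x hx.1 y hy.1 h

lemma lp_route_aux {d : ℕ} (π : Equiv.Perm (Fin d)) (M : Finset (Fin d → Bool)) (hM : lpBal π M)
    (A : Finset (Fin d → Bool)) (hA : A.card = M.card) (j : ℕ) (hj : j ≤ d) :
    ∃ Q : (Fin d → Bool) → ℕ → (Fin d → Bool), (∀ a, Q a 0 = a) ∧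
      (∀ a i (hi : i < d), i < j → ∀ k, k ≠ π ⟨i, hi⟩ → Q a i k = Q a (i+1) k) ∧
      (∀ i, i ≤ j → ∀ a ∈ A, ∀ a' ∈ A, Q a i = Q a' i → a = a') ∧
      ∀ n (N K : Finset (Fin d → Bool)),
        (∀ x, x ∈ N ↔ x ∈ A.image (fun a => Q a j) ∧ lpE π j n x) →
        (∀ x, x ∈ K ↔ x ∈ M ∧ lpE π j n x) → N.card = K.card := by
  induction j with
  | zero =>
    refine ⟨fun a _ => a, fun _ => rfl, fun _ _ _ h => by omega, fun _ _ _ _ _ _ h => h, ?_⟩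
    intro n N K hN hK
    have h1 : N = A := by ext x; rw [hN]; simp [lpE]
    have h2 : K = M := by ext x; rw [hK]; simp [lpE]
    rw [h1, h2, hA]
  | succ j ih =>
    obtain ⟨Q, h0, hs, hi, hc⟩ := ih (by omega)
    obtain ⟨g, g1, g2, g3⟩ := lp_layer π M hM j (by omega) _ hc
    refine ⟨fun a i => if i ≤ j then Q a i else g (Q a j), ?_, ?_, ?_, ?_⟩
    · intro a; simp [h0]
    · intro a i hid hij k hk
      by_cases h : i = j
      · subst h
        simpa using g1 (Q a i) k hk
      · have q1 : i ≤ j := by omega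
        have q2 : i + 1 ≤ j := by omega
        simp only [q1, q2, if_true]
        exact hs a i hid (by omega) k hk
    · intro i hij a ha a' ha' h
      by_cases q : i ≤ j
      · simp only [q, if_true] at h
        exact hi i q a ha a' ha' h
      · simp only [q, if_false] at h
        exact hi j le_rfl a ha a' ha' (g2 _ (Finset.mem_image_of_mem _ ha) _
          (Finset.mem_image_of_mem _ ha') h)
    · intro n N K hN hK
      refine g3 n N K ?_ hK
      intro x
      rw [hN, Finset.image_image]
      simp [Function.comp_def]

lemma lp_route {d : ℕ} (π : Equiv.Perm (Fin d)) (M : Finset (Fin d → Bool)) (hM : lpBal π M)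
    (A : Finset (Fin d → Bool)) (hA : A.card = M.card) :
    ∃ Q : (Fin d → Bool) → ℕ → (Fin d → Bool), (∀ a, Q a 0 = a) ∧
      (∀ a i (hi : i < d), ∀ k, k ≠ π ⟨i, hi⟩ → Q a i k = Q a (i+1) k) ∧
      (∀ i, i ≤ d → ∀ a ∈ A, ∀ a' ∈ A, Q a i = Q a' i → a = a') ∧
      A.image (fun a => Q a d) = M := by
  classical
  obtain ⟨Q, h0, hs, hi, hc⟩ := lp_route_aux π M hM A hA d le_rfl
  refine ⟨Q, h0, fun a i hid => hs a i hid hid, hi, ?_⟩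
  ext x
  have := hc x ((A.image (fun a => Q a d)).filter (fun y => y = x)) (M.filter (fun y => y = x))
    (fun y => by
      rw [Finset.mem_filter]
      exact and_congr_right fun _ => ⟨fun h => h ▸ lpE_refl _ _ _, fun h => (lpE_full h).symm⟩)
    (fun y => by
      rw [Finset.mem_filter]
      exact and_congr_right fun _ => ⟨fun h => h ▸ lpE_refl _ _ _, fun h => (lpE_full h).symm⟩)
  rw [Finset.filter_eq', Finset.filter_eq'] at this
  split_ifs at this with p q q
  · simp [p, q]
  · simp at this
  · simp at this
  · simp [p, q]

/-- Every pair of `d`-dimensional layer-permuted butterflies is a superconcentrator: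
for any set `A` of input (layer-`0`) nodes and any set `B` of output (layer-`2d`) nodes
with `|A| = |B|`, there is a family of directed paths, one per element of `A`, pairwise
vertex-disjoint (vertices on different layers are automatically distinct, so
disjointness is stated layerwise), starting exactly at the elements of `A` and ending
exactly at the elements of `B`. -/
theorem layer_permuted_pair_superconcentrator
    (d : ℕ) (hd : 1 ≤ d) (π σ : Equiv.Perm (Fin d))
    (A B : Finset (Fin d → Bool)) (hAB : A.card = B.card) :
    ∃ P : (Fin d → Bool) → ℕ → (Fin d → Bool),
      (∀ a ∈ A, P a 0 = a) ∧
      (∀ a ∈ A, ∀ i, i < 2 * d → lpStep d π σ i (P a i) (P a (i + 1))) ∧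
      (∀ a ∈ A, ∀ a' ∈ A, a ≠ a' → ∀ i, i ≤ 2 * d → P a i ≠ P a' i) ∧
      A.image (fun a => P a (2 * d)) = B := by
  classical
  obtain ⟨M, hMc, hM1, hM2⟩ := lp_exists_bal π (Fin.revPerm.trans σ) A.card (by
    have := Finset.card_le_univ A
    simpa using this)
  obtain ⟨Q, q0, qs, qi, qM⟩ := lp_route π M hM1 A hMc.symm
  obtain ⟨R, r0, rs, ri, rM⟩ := lp_route (Fin.revPerm.trans σ) M hM2 B (by omega)
  have hψ : ∀ a, ∃ b, a ∈ A → b ∈ B ∧ R b d = Q a d := by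
    intro a
    by_cases ha : a ∈ A
    · have : Q a d ∈ B.image (fun b => R b d) := by
        rw [rM, ← qM]; exact Finset.mem_image_of_mem _ ha
      obtain ⟨b, hb, h⟩ := Finset.mem_image.1 this
      exact ⟨b, fun _ => ⟨hb, h⟩⟩
    · exact ⟨a, fun h => absurd h ha⟩
  choose ψ hψ using hψ
  have ψinj : ∀ a ∈ A, ∀ a' ∈ A, ψ a = ψ a' → a = a' := by
    intro a ha a' ha' h
    apply qi d le_rfl a ha a' ha'
    rw [← (hψ a ha).2, ← (hψ a' ha').2, h]
  refine ⟨fun a i => if i ≤ d then Q a i else R (ψ a) (2 * d - i), ?_, ?_, ?_, ?_⟩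
  · intro a _; simp [q0]
  · intro a ha i hi
    unfold lpStep
    by_cases h : i < d
    · rw [dif_pos h]
      intro k hk
      have h1 : i ≤ d := by omega
      have h2 : i + 1 ≤ d := by omega
      simp only [h1, h2, if_true]
      exact qs a i h k hk
    · rw [dif_neg h, dif_pos hi]
      intro k hk
      have h2 : ¬ (i + 1 ≤ d) := by omega
      have e1 : (if i ≤ d then Q a i else R (ψ a) (2 * d - i)) = R (ψ a) (2 * d - i) := by
        split_ifs with h3
        · have : i = d := by omega
          subst this
          rw [← (hψ a ha).2]
          congr 1
          omega
        · rfl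
      simp only [h2, if_false]
      rw [e1]
      have := rs (ψ a) (2 * d - (i + 1)) (by omega) k (by
        intro hk'
        apply hk
        rw [hk']
        simp only [Equiv.trans_apply, Fin.revPerm_apply]
        congr 1
        ext
        simp only [Fin.val_rev]
        omega)
      rw [this]
      congr 1
      omega
  · intro a ha a' ha' hne i hi h
    by_cases h1 : i ≤ d
    · simp only [h1, if_true] at h
      exact hne (qi i h1 a ha a' ha' h)
    · simp only [h1, if_false] at h
      exact hne (ψinj a ha a' ha' (ri _ (by omega) _ (hψ a ha).1 _ (hψ a' ha').1 h))
  · have h1 : ¬ (2 * d ≤ d) := by omega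
    simp only [h1, if_false, Nat.sub_self, r0]
    apply Finset.eq_of_subset_of_card_le
    · intro b hb
      obtain ⟨a, ha, rfl⟩ := Finset.mem_image.1 hb
      exact (hψ a ha).1
    · rw [Finset.card_image_of_injOn (fun a ha a' ha' h => ψinj a ha a' ha' h), hAB]
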